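/- For every integer q ≥ 4 divisible by 4 and any 3q + 1 points p₁,…,p_{3q+1} ∈ ℝP², there exists a nonzero homogeneous polynomial F ∈ ℝ[x₀,x₁,x₂] of degree q such that some connected component of the real point set Z(F) contains all of the points (i.e. for q = 4k the lower bound 3q − 1 = 12k − 1 on c(q) can be improved to 12k + 1). -/

import Mathlib

noncomputable section

/-- The real projective plane, the projectivization of `ℝ³`. -/
abbrev RP2 := Projectivization ℝ (Fin 3 → ℝ)

/-- `ℝP²` carries the quotient topology from `ℝ³ ∖ {0}`. -/
instance : TopologicalSpace RP2 :=
  inferInstanceAs (TopologicalSpace (Quotient (projectivizationSetoid ℝ (Fin 3 → ℝ))))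

/-- The real point set of the plane curve defined by `F ∈ ℝ[x₀,x₁,x₂]`; for homogeneous `F`
this is well defined (independent of the representative). -/
def zeroSet (F : MvPolynomial (Fin 3) ℝ) : Set RP2 :=
  {p | MvPolynomial.eval p.rep F = 0}

/-- The set `S` lies in a single connected component of `Z ⊆ ℝP²` (with the subspace topology):
some connected component of `Z` contains `S`. -/
def inOneComponent (Z S : Set RP2) : Prop :=
  ∃ p ∈ Z, S ⊆ connectedComponentIn Z p

/-- Two points are connected within `A` if some preconnected subset of `A` contains both. -/
def ConnectedWithin {X : Type*} [TopologicalSpace X] (A : Set X) (x y : X) : Prop :=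
  ∃ C ⊆ A, IsPreconnected C ∧ x ∈ C ∧ y ∈ C

/-- Every circle-valued map on `X` has a continuous real-valued angle. -/
def HasAngles (X : Type*) [TopologicalSpace X] : Prop :=
  ∀ f : C(X, Circle), ∃ θ : C(X, ℝ), ∀ x, Circle.exp (θ x) = f x

section Topology

variable {X : Type*} [TopologicalSpace X]

theorem ConnectedWithin.symm {A : Set X} {x y : X} (h : ConnectedWithin A x y) :
    ConnectedWithin A y x := by
  obtain ⟨C, hCA, hC, hx, hy⟩ := h
  exact ⟨C, hCA, hC, hy, hx⟩

theorem ConnectedWithin.trans {A : Set X} {x y z : X} (h : ConnectedWithin A x y)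
    (h' : ConnectedWithin A y z) : ConnectedWithin A x z := by
  obtain ⟨C, hCA, hC, hx, hy⟩ := h
  obtain ⟨D, hDA, hD, hy', hz⟩ := h'
  exact ⟨C ∪ D, Set.union_subset hCA hDA, hC.union y hy hy' hD, Or.inl hx, Or.inr hz⟩

theorem ConnectedWithin.mono {A B : Set X} {x y : X} (h : ConnectedWithin A x y) (hAB : A ⊆ B) :
    ConnectedWithin B x y := by
  obtain ⟨C, hCA, hC⟩ := h
  exact ⟨C, hCA.trans hAB, hC⟩

theorem ConnectedWithin.right_mem {A : Set X} {x y : X} (h : ConnectedWithin A x y) : y ∈ A := by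
  obtain ⟨C, hCA, -, -, hy⟩ := h
  exact hCA hy

theorem ConnectedWithin.left_mem {A : Set X} {x y : X} (h : ConnectedWithin A x y) : x ∈ A :=
  h.symm.right_mem

theorem ConnectedWithin.left_of_union {U V : Set X} {x y : X} (h : ConnectedWithin (U ∪ V) x y)
    (hU : IsClosed U) (hV : IsClosed V) (hUV : Disjoint U V) (hx : x ∈ U) :
    ConnectedWithin U x y := by
  obtain ⟨C, hC, hCp, hxC, hyC⟩ := h
  refine ⟨C, ?_, hCp, hxC, hyC⟩
  rcases isPreconnected_iff_subset_of_disjoint_closed.mp hCp U V hU hV hC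
    (by rw [hUV.inter_eq, Set.inter_empty]) with h | h
  · exact h
  · exact (hUV.le_bot ⟨hx, h hxC⟩).elim

theorem exists_isClosed_separation [CompactSpace X] [T2Space X] {A : Set X} (hA : IsClosed A)
    {x y : X} (hx : x ∈ A) (hy : y ∈ A) (h : ¬ ConnectedWithin A x y) :
    ∃ A₁ A₂ : Set X, IsClosed A₁ ∧ IsClosed A₂ ∧ Disjoint A₁ A₂ ∧ A₁ ∪ A₂ = A ∧
      x ∈ A₁ ∧ y ∈ A₂ := by
  have : CompactSpace A := isCompact_iff_compactSpace.mp hA.isCompact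
  have hy' : (⟨y, hy⟩ : A) ∉ connectedComponent (⟨x, hx⟩ : A) := by
    intro hmem
    refine h ⟨Subtype.val '' connectedComponent (⟨x, hx⟩ : A), by simp,
      isPreconnected_connectedComponent.image _ continuous_subtype_val.continuousOn,
      ⟨_, mem_connectedComponent, rfl⟩, ⟨_, hmem, rfl⟩⟩
  rw [connectedComponent_eq_iInter_isClopen, Set.mem_iInter] at hy'
  push Not at hy'
  obtain ⟨⟨U, hU, hxU⟩, hyU⟩ := hy'
  refine ⟨Subtype.val '' U, Subtype.val '' Uᶜ, hA.isClosedEmbedding_subtypeVal.isClosedMap _ hU.1,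
    hA.isClosedEmbedding_subtypeVal.isClosedMap _ hU.compl.1, ?_, ?_, ⟨_, hxU, rfl⟩,
    ⟨_, hyU, rfl⟩⟩
  · exact (Set.disjoint_image_iff Subtype.val_injective).mpr disjoint_compl_right
  · rw [← Set.image_union, Set.union_compl_self, Set.image_univ, Subtype.range_coe]

theorem IsPreconnected.eq_of_circleExp_eq_one {S : Set X} (hS : IsPreconnected S) {g : X → ℝ}
    (hg : ContinuousOn g S) (h : ∀ x ∈ S, Circle.exp (g x) = 1) {x y : X} (hx : x ∈ S)
    (hy : y ∈ S) : g x = g y :=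
  (Circle.isCoveringMap_exp.eqOn_of_comp_eqOn hS hg continuousOn_const
    (g₂ := fun _ => g y) (fun z hz => by simp [h z hz, h y hy]) hy rfl) hx

/-- Unicoherence: if two closed sets cover `X`, two points that are connected within each of them
are not separated in the intersection. -/
theorem HasAngles.false_of_separation [NormalSpace X] (hX : HasAngles X) {A B Z₁ Z₂ : Set X}
    (hA : IsClosed A) (hB : IsClosed B) (hAB : A ∪ B = Set.univ)
    (hZ₁ : IsClosed Z₁) (hZ₂ : IsClosed Z₂) (hdisj : Disjoint Z₁ Z₂) (hZ : A ∩ B ⊆ Z₁ ∪ Z₂)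
    {x y : X} (hx : x ∈ Z₁) (hy : y ∈ Z₂) (hxyA : ConnectedWithin A x y)
    (hxyB : ConnectedWithin B x y) : False := by
  obtain ⟨φ, hφ₁, hφ₂, -⟩ := exists_continuous_zero_one_of_isClosed hZ₁ hZ₂ hdisj
  classical
  have hpi : Circle.exp Real.pi = Circle.exp (-Real.pi) := by
    rw [Circle.exp_eq_exp]
    exact ⟨1, by push_cast; ring⟩
  let f : X → Circle := fun z =>
    if z ∈ A then Circle.exp (Real.pi * φ z) else Circle.exp (-(Real.pi * φ z))
  have hfA : ∀ z ∈ A, f z = Circle.exp (Real.pi * φ z) := fun z hz => if_pos hz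
  have hfB : ∀ z ∈ B, f z = Circle.exp (-(Real.pi * φ z)) := by
    intro z hz
    by_cases hzA : z ∈ A
    · rw [hfA z hzA]
      rcases hZ ⟨hzA, hz⟩ with h | h
      · simp [hφ₁ h]
      · have e := hφ₂ h
        simp only [Pi.one_apply] at e
        rw [e, mul_one, hpi]
    · exact if_neg hzA
  have hf : Continuous f := by
    rw [← continuousOn_univ, ← hAB]
    refine ContinuousOn.union_of_isClosed ?_ ?_ hA hB
    · refine ContinuousOn.congr (Continuous.continuousOn ?_) hfA
      fun_prop
    · refine ContinuousOn.congr (Continuous.continuousOn ?_) hfB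
      fun_prop
  obtain ⟨θ, hθ⟩ := hX ⟨f, hf⟩
  obtain ⟨C, hCA, hC, hxC, hyC⟩ := hxyA
  obtain ⟨D, hDB, hD, hxD, hyD⟩ := hxyB
  have h₁ := hC.eq_of_circleExp_eq_one (g := fun z => θ z - Real.pi * φ z)
    (Continuous.continuousOn (by fun_prop))
    (fun z hz => by simp [Circle.exp_sub, hθ, hfA z (hCA hz)]) hxC hyC
  have h₂ := hD.eq_of_circleExp_eq_one (g := fun z => θ z + Real.pi * φ z)
    (Continuous.continuousOn (by fun_prop))
    (fun z hz => by simp [Circle.exp_add, hθ, hfB z (hDB hz), Circle.exp_neg]) hxD hyD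
  have e₁ := hφ₁ hx
  have e₂ := hφ₂ hy
  simp only [Pi.zero_apply, Pi.one_apply] at e₁ e₂
  simp only [e₁, e₂] at h₁ h₂
  linarith [Real.pi_pos]

theorem HasAngles.connectedWithin_inter [CompactSpace X] [T2Space X] (hX : HasAngles X)
    {A B : Set X} (hA : IsClosed A) (hB : IsClosed B) (hAB : A ∪ B = Set.univ) {x y : X}
    (hxyA : ConnectedWithin A x y) (hxyB : ConnectedWithin B x y) :
    ConnectedWithin (A ∩ B) x y := by
  by_contra h
  obtain ⟨Z₁, Z₂, h₁, h₂, hd, hZ, hx₁, hy₂⟩ := exists_isClosed_separation (hA.inter hB)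
    ⟨hxyA.left_mem, hxyB.left_mem⟩ ⟨hxyA.right_mem, hxyB.right_mem⟩ h
  exact hX.false_of_separation hA hB hAB h₁ h₂ hd hZ.ge hx₁ hy₂ hxyA hxyB

/-- If any point of `A` can be joined to any point of `B` by first moving within `A` and then
within `B`, then one of `A` and `B` does not separate points. -/
theorem HasAngles.connectedWithin_or [CompactSpace X] [T2Space X] (hX : HasAngles X)
    {A B : Set X} (hA : IsClosed A) (hB : IsClosed B) (hAB : A ∪ B = Set.univ)
    (hadj : ∀ a ∈ A, ∀ b ∈ B, ∃ z, ConnectedWithin A a z ∧ ConnectedWithin B z b) :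
    (∀ x ∈ A, ∀ y ∈ A, ConnectedWithin A x y) ∨ ∀ x ∈ B, ∀ y ∈ B, ConnectedWithin B x y := by
  by_contra! h
  obtain ⟨⟨p, hp, q, hq, hpq⟩, r, hr, s, hs, hrs⟩ := h
  obtain ⟨A₁, A₂, hA₁, hA₂, hAd, rfl, hpA, hqA⟩ := exists_isClosed_separation hA hp hq hpq
  obtain ⟨B₁, B₂, hB₁, hB₂, hBd, rfl, hrB, hsB⟩ := exists_isClosed_separation hB hr hs hrs
  obtain ⟨a, hpa, har⟩ := hadj p hp r hr
  obtain ⟨b, hpb, hbs⟩ := hadj p hp s hs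
  obtain ⟨c, hqc, hcr⟩ := hadj q hq r hr
  obtain ⟨d, hqd, hds⟩ := hadj q hq s hs
  replace hpa := hpa.left_of_union hA₁ hA₂ hAd hpA
  replace hpb := hpb.left_of_union hA₁ hA₂ hAd hpA
  rw [Set.union_comm] at hqc hqd
  replace hqc := hqc.left_of_union hA₂ hA₁ hAd.symm hqA
  replace hqd := hqd.left_of_union hA₂ hA₁ hAd.symm hqA
  replace har := har.symm.left_of_union hB₁ hB₂ hBd hrB
  replace hcr := hcr.symm.left_of_union hB₁ hB₂ hBd hrB
  rw [Set.union_comm B₁] at hbs hds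
  replace hbs := hbs.symm.left_of_union hB₂ hB₁ hBd.symm hsB
  replace hds := hds.symm.left_of_union hB₂ hB₁ hBd.symm hsB
  refine hX.false_of_separation (A := A₁ ∪ B₁) (B := A₂ ∪ B₂) (Z₁ := A₁ ∩ B₂) (Z₂ := A₂ ∩ B₁)
    (x := b) (y := c) (hA₁.union hB₁) (hA₂.union hB₂) ?_ (hA₁.inter hB₂) (hA₂.inter hB₁)
    (hAd.mono Set.inter_subset_left Set.inter_subset_left) ?_ ⟨hpb.right_mem, hbs.right_mem⟩
    ⟨hqc.right_mem, hcr.right_mem⟩ ?_ ?_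
  · rw [← hAB, Set.union_union_union_comm]
  · rintro z ⟨h₁ | h₁, h₂ | h₂⟩
    · exact (hAd.le_bot ⟨h₁, h₂⟩).elim
    · exact Or.inl ⟨h₁, h₂⟩
    · exact Or.inr ⟨h₂, h₁⟩
    · exact (hBd.le_bot ⟨h₁, h₂⟩).elim
  · exact ((hpb.symm.trans hpa).mono Set.subset_union_left).trans
      ((har.symm.trans hcr).mono Set.subset_union_right)
  · exact ((hbs.symm.trans hds).mono Set.subset_union_right).trans
      ((hqd.symm.trans hqc).mono Set.subset_union_left)

/-- Connectedness of two fixed points within a superlevel set is a closed condition on a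
parameter. -/
theorem isClosed_setOf_connectedWithin [CompactSpace X] [T2Space X] {Y : Type*}
    [TopologicalSpace Y] {h : Y → X → ℝ} (hh : Continuous fun z : Y × X => h z.1 z.2) {x y : X}
    (hx : ∀ t, 0 ≤ h t x) (hy : ∀ t, 0 ≤ h t y) :
    IsClosed {t | ConnectedWithin {z | 0 ≤ h t z} x y} := by
  rw [← isOpen_compl_iff, isOpen_iff_mem_nhds]
  intro t ht
  have hcl : IsClosed {z | 0 ≤ h t z} :=
    isClosed_le continuous_const (hh.comp (Continuous.prodMk_right t))
  obtain ⟨A₁, A₂, hA₁, hA₂, hd, hA, hxA, hyA⟩ := exists_isClosed_separation hcl (hx t) (hy t) ht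
  obtain ⟨U₁, U₂, hU₁, hU₂, hAU₁, hAU₂, hU⟩ := normal_separation hA₁ hA₂ hd
  have hK : IsCompact (U₁ ∪ U₂)ᶜ := (hU₁.union hU₂).isClosed_compl.isCompact
  obtain ⟨u, v, hu, -, htu, hKv, huv⟩ := generalized_tube_lemma (isCompact_singleton (x := t)) hK
    (isOpen_lt hh continuous_const) (n := {z : Y × X | h z.1 z.2 < 0}) (by
      rintro ⟨t', z⟩ ⟨rfl, hz⟩
      by_contra hneg
      have : z ∈ A₁ ∪ A₂ := hA ▸ (not_lt.mp hneg : 0 ≤ h t' z)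
      exact hz (this.imp (fun h => hAU₁ h) (fun h => hAU₂ h)))
  filter_upwards [hu.mem_nhds (htu rfl)] with t' ht' ⟨C, hC, hCp, hxC, hyC⟩
  have hCU : C ⊆ U₁ ∪ U₂ := by
    intro z hz
    by_contra hzU
    have hlt : h t' z < 0 := huv (Set.mk_mem_prod ht' (hKv hzU))
    exact absurd (hC hz : 0 ≤ h t' z) hlt.not_ge
  have := hCp.subset_left_of_subset_union hU₁ hU₂ hU hCU ⟨x, hxC, hAU₁ hxA⟩
  exact hU.le_bot ⟨this hyC, hAU₂ hyA⟩

/-- In a pencil of functions each of which satisfies the alternative of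
`HasAngles.connectedWithin_or`, the base points are connected within some zero set. -/
theorem HasAngles.exists_connectedWithin_pencil [CompactSpace X] [T2Space X] (hX : HasAngles X)
    (f g : C(X, ℝ)) {S : Set X} (hf : ∀ x ∈ S, f x = 0) (hg : ∀ x ∈ S, g x = 0)
    (hadj : ∀ (t : ℝ) (a b : X), 0 ≤ Real.cos t * f a + Real.sin t * g a →
      Real.cos t * f b + Real.sin t * g b ≤ 0 →
      ∃ z, ConnectedWithin {z | 0 ≤ Real.cos t * f z + Real.sin t * g z} a z ∧
        ConnectedWithin {z | Real.cos t * f z + Real.sin t * g z ≤ 0} z b) :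
    ∃ t : ℝ, ∀ x ∈ S, ∀ y ∈ S,
      ConnectedWithin {z | Real.cos t * f z + Real.sin t * g z = 0} x y := by
  let h : ℝ → X → ℝ := fun t z => Real.cos t * f z + Real.sin t * g z
  have hS : ∀ t, ∀ x ∈ S, h t x = 0 := fun t x hx => by simp [h, hf x hx, hg x hx]
  have hh : Continuous fun z : ℝ × X => h z.1 z.2 := by fun_prop
  have hneg : ∀ t z, h (t + Real.pi) z = -h t z := fun t z => by
    simp only [h, Real.cos_add_pi, Real.sin_add_pi]; ring
  let T : Set ℝ := {t | ∀ x ∈ S, ∀ y ∈ S, ConnectedWithin {z | 0 ≤ h t z} x y}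
  have hT : IsClosed T := by
    simp only [T, Set.ofPred_forall]
    refine isClosed_iInter fun x => isClosed_iInter fun hx => isClosed_iInter fun y =>
      isClosed_iInter fun hy => isClosed_setOf_connectedWithin hh
        (fun t => (hS t x hx).ge) (fun t => (hS t y hy).ge)
  let T' : Set ℝ := (fun t => t + Real.pi) ⁻¹' T
  have hT' : IsClosed T' := hT.preimage (by fun_prop)
  have mem_T' : ∀ t, t ∈ T' ↔ ∀ x ∈ S, ∀ y ∈ S, ConnectedWithin {z | h t z ≤ 0} x y := by
    intro t
    simp only [T', T, Set.mem_preimage, Set.mem_ofPred_eq, hneg, Left.nonneg_neg_iff]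
  have hclA : ∀ t, IsClosed {z | 0 ≤ h t z} := fun t =>
    isClosed_le continuous_const (hh.comp (Continuous.prodMk_right t))
  have hclB : ∀ t, IsClosed {z | h t z ≤ 0} := fun t =>
    isClosed_le (hh.comp (Continuous.prodMk_right t)) continuous_const
  have hun : ∀ t, {z | 0 ≤ h t z} ∪ {z | h t z ≤ 0} = Set.univ := fun t => by
    ext z; simpa using le_total 0 (h t z)
  have hcover : ∀ t, t ∈ T ∨ t ∈ T' := by
    intro t
    rcases hX.connectedWithin_or (hclA t) (hclB t) (hun t) (fun a ha b hb => hadj t a b ha hb)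
      with H | H
    · exact Or.inl fun x hx y hy => H x (hS t x hx).ge y (hS t y hy).ge
    · exact Or.inr ((mem_T' t).2 fun x hx y hy => H x (hS t x hx).le y (hS t y hy).le)
  have hper : ∀ t, t ∈ T → t - Real.pi ∈ T' := fun t ht => by
    simpa [T'] using ht
  have hper' : ∀ t, t ∈ T' → t + Real.pi ∈ T := fun t ht => ht
  obtain ⟨t, -, htT, htT'⟩ := isPreconnected_closed_iff.mp (isPreconnected_univ (α := ℝ)) T T' hT hT'
    (fun t _ => hcover t)
    (by rcases hcover 0 with h | h
        exacts [⟨_, trivial, h⟩, ⟨_, trivial, hper' _ h⟩])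
    (by rcases hcover 0 with h | h
        exacts [⟨_, trivial, hper _ h⟩, ⟨_, trivial, h⟩])
  refine ⟨t, fun x hx y hy => ?_⟩
  refine (hX.connectedWithin_inter (hclA t) (hclB t) (hun t) (htT x hx y hy)
    ((mem_T' t).1 htT' x hx y hy)).mono ?_
  rintro z ⟨h₁, h₂⟩
  exact le_antisymm h₂ h₁

end Topology

section ProjectivePlane

theorem RP2.isQuotientMap_mk' :
    Topology.IsQuotientMap (fun v : {v : Fin 3 → ℝ // v ≠ 0} => (Projectivization.mk' ℝ v : RP2)) :=
  isQuotientMap_quot_mk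

theorem RP2.continuous_mk {Y : Type*} [TopologicalSpace Y] {f : Y → Fin 3 → ℝ} (hf : Continuous f)
    (h : ∀ y, f y ≠ 0) : Continuous fun y => (Projectivization.mk ℝ (f y) (h y) : RP2) :=
  RP2.isQuotientMap_mk'.continuous.comp (hf.subtype_mk h)

theorem sum_sq_pos {v : Fin 3 → ℝ} (hv : v ≠ 0) : 0 < ∑ i, v i ^ 2 := by
  obtain ⟨i, hi⟩ := Function.ne_iff.mp hv
  exact Finset.sum_pos' (fun i _ => sq_nonneg _) ⟨i, Finset.mem_univ i, by
    have : v i ≠ 0 := hi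
    positivity⟩

theorem MvPolynomial.IsHomogeneous.eval_smul {σ R : Type*} [Fintype σ] [CommSemiring R]
    {F : MvPolynomial σ R} {n : ℕ} (hF : F.IsHomogeneous n) (a : R) (v : σ → R) :
    MvPolynomial.eval (a • v) F = a ^ n * MvPolynomial.eval v F := by
  rw [MvPolynomial.eval_eq, MvPolynomial.eval_eq, Finset.mul_sum]
  refine Finset.sum_congr rfl fun d hd => ?_
  simp only [Pi.smul_apply, smul_eq_mul, mul_pow, Finset.prod_mul_distrib,
    Finset.prod_pow_eq_pow_sum, ← hF.degree_eq_sum_deg_support hd]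
  ring

/-- The normalized value of a form of degree `4` at a point of the projective plane. -/
def quarticValue (F : MvPolynomial (Fin 3) ℝ) (p : RP2) : ℝ :=
  MvPolynomial.eval p.rep F / (∑ i, p.rep i ^ 2) ^ 2

theorem quarticValue_mk {F : MvPolynomial (Fin 3) ℝ} (hF : F.IsHomogeneous 4) (v : Fin 3 → ℝ)
    (hv : v ≠ 0) :
    quarticValue F (Projectivization.mk ℝ v hv) =
      MvPolynomial.eval v F / (∑ i, v i ^ 2) ^ 2 := by
  obtain ⟨a, ha⟩ := Projectivization.exists_smul_eq_mk_rep ℝ v hv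
  have ha0 : (a : ℝ) ≠ 0 := a.ne_zero
  have hs := (sum_sq_pos hv).ne'
  have h2 : ∑ i, ((a : ℝ) • v) i ^ 2 = (a : ℝ) ^ 2 * ∑ i, v i ^ 2 := by
    simp [Finset.mul_sum, mul_pow]
  rw [quarticValue, ← ha, Units.smul_def, hF.eval_smul, h2]
  field_simp

theorem continuous_quarticValue {F : MvPolynomial (Fin 3) ℝ} (hF : F.IsHomogeneous 4) :
    Continuous (quarticValue F) := by
  rw [RP2.isQuotientMap_mk'.continuous_iff]
  have : (quarticValue F ∘ fun v : {v : Fin 3 → ℝ // v ≠ 0} => (Projectivization.mk' ℝ v : RP2)) =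
      fun v => MvPolynomial.eval v.1 F / (∑ i, v.1 i ^ 2) ^ 2 := by
    funext v
    exact quarticValue_mk hF v.1 v.2
  rw [this]
  have hsum : Continuous fun v : Fin 3 → ℝ => (∑ i, v i ^ 2) ^ 2 := by fun_prop
  refine Continuous.div ?_ (hsum.comp continuous_subtype_val) fun v => (pow_pos (sum_sq_pos v.2) 2).ne'
  exact F.continuous_eval.comp continuous_subtype_val

instance : T2Space RP2 := by
  let Q : Fin 3 × Fin 3 → MvPolynomial (Fin 3) ℝ := fun ij =>
    MvPolynomial.X ij.1 * MvPolynomial.X ij.2 * ∑ k, MvPolynomial.X k ^ 2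
  have hQ : ∀ ij, (Q ij).IsHomogeneous 4 := fun ij =>
    ((MvPolynomial.isHomogeneous_X _ _).mul (MvPolynomial.isHomogeneous_X _ _)).mul
      (MvPolynomial.IsHomogeneous.sum _ _ 2 fun k _ => MvPolynomial.isHomogeneous_X_pow k 2)
  refine T2Space.of_injective_continuous (f := fun p ij => quarticValue (Q ij) p) ?_
    (continuous_pi fun ij => continuous_quarticValue (hQ ij))
  intro p q
  induction p using Projectivization.ind with | h v hv
  induction q using Projectivization.ind with | h w hw
  intro hpq
  have hv' := (sum_sq_pos hv).ne'
  have hw' := (sum_sq_pos hw).ne'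
  have key : ∀ i j, v i * v j / ∑ k, v k ^ 2 = w i * w j / ∑ k, w k ^ 2 := by
    intro i j
    have := congrFun hpq (i, j)
    simp only [quarticValue_mk (hQ (i, j)), Q, map_mul, map_sum, map_pow,
      MvPolynomial.eval_X] at this
    rw [← mul_div_mul_right _ _ hv', ← mul_div_mul_right (w i * w j) _ hw']
    simpa only [sq (∑ k, v k ^ 2), sq (∑ k, w k ^ 2)] using this
  obtain ⟨i, hi⟩ := Function.ne_iff.mp hv
  have hi' : v i ≠ 0 := hi
  rw [Projectivization.mk_eq_mk_iff']
  refine ⟨(∑ k, v k ^ 2) * w i / (v i * ∑ k, w k ^ 2), ?_⟩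
  funext j
  have := key i j
  simp only [Pi.smul_apply, smul_eq_mul]
  field_simp at this ⊢
  linear_combination -this

/-- The point of the upper half sphere above a point of the unit disc. -/
def hemisphere (z : ℂ) : Fin 3 → ℝ := ![z.re, z.im, Real.sqrt (1 - ‖z‖ ^ 2)]

theorem hemisphere_ne_zero (z : ℂ) : hemisphere z ≠ 0 := by
  intro h
  have h0 : z.re = 0 := congrFun h 0
  have h1 : z.im = 0 := congrFun h 1
  have h2 : Real.sqrt (1 - ‖z‖ ^ 2) = 0 := congrFun h 2
  have : z = 0 := Complex.ext h0 h1
  simp [this] at h2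

/-- The parametrization of the projective plane by the unit disc. -/
def discToRP2 (z : ℂ) : RP2 := Projectivization.mk ℝ (hemisphere z) (hemisphere_ne_zero z)

theorem continuous_discToRP2 : Continuous discToRP2 := by
  refine RP2.continuous_mk (continuous_pi fun i => ?_) hemisphere_ne_zero
  fin_cases i
  · exact Complex.continuous_re
  · exact Complex.continuous_im
  · change Continuous fun z : ℂ => Real.sqrt (1 - ‖z‖ ^ 2)
    fun_prop

theorem exists_discToRP2_eq (p : RP2) : ∃ z : ℂ, ‖z‖ ≤ 1 ∧ discToRP2 z = p := by
  induction p using Projectivization.ind with | h v hv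
  wlog h2 : 0 ≤ v 2 generalizing v
  · obtain ⟨z, hz, h⟩ := this (-v) (neg_ne_zero.mpr hv) (by simp; linarith)
    refine ⟨z, hz, h.trans ?_⟩
    rw [Projectivization.mk_eq_mk_iff']
    exact ⟨-1, by simp⟩
  have hpos := sum_sq_pos hv
  set r := Real.sqrt (∑ i, v i ^ 2) with hr
  have hr0 : 0 < r := Real.sqrt_pos.mpr hpos
  have hr2 : r ^ 2 = v 0 ^ 2 + v 1 ^ 2 + v 2 ^ 2 := by
    rw [hr, Real.sq_sqrt hpos.le, Fin.sum_univ_three]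
  have hn : ‖(⟨v 0 / r, v 1 / r⟩ : ℂ)‖ ^ 2 = 1 - (v 2 / r) ^ 2 := by
    rw [Complex.sq_norm, Complex.normSq_mk]
    field_simp
    linarith
  refine ⟨⟨v 0 / r, v 1 / r⟩, ?_, ?_⟩
  · rw [← sq_le_one_iff₀ (norm_nonneg _), hn]
    linarith [sq_nonneg (v 2 / r)]
  · rw [discToRP2, Projectivization.mk_eq_mk_iff']
    refine ⟨r⁻¹, ?_⟩
    funext i
    have : hemisphere ⟨v 0 / r, v 1 / r⟩ 2 = v 2 / r := by
      change Real.sqrt (1 - _) = _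
      rw [hn, sub_sub_cancel, Real.sqrt_sq (by positivity)]
    fin_cases i
    · exact inv_mul_eq_div _ _
    · exact inv_mul_eq_div _ _
    · exact (inv_mul_eq_div _ _).trans this.symm

theorem eq_or_antipodal_of_discToRP2_eq {z w : ℂ} (hz : ‖z‖ ≤ 1) (hw : ‖w‖ ≤ 1)
    (h : discToRP2 z = discToRP2 w) : z = w ∨ ‖z‖ = 1 ∧ w = -z := by
  rw [discToRP2, discToRP2, Projectivization.mk_eq_mk_iff'] at h
  obtain ⟨a, ha⟩ := h
  have h0 : a * w.re = z.re := congrFun ha 0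
  have h1 : a * w.im = z.im := congrFun ha 1
  have h2 : a * Real.sqrt (1 - ‖w‖ ^ 2) = Real.sqrt (1 - ‖z‖ ^ 2) := congrFun ha 2
  have hz' : 0 ≤ 1 - ‖z‖ ^ 2 := by nlinarith [norm_nonneg z]
  have hw' : 0 ≤ 1 - ‖w‖ ^ 2 := by nlinarith [norm_nonneg w]
  have sz := Real.sq_sqrt hz'
  have sw := Real.sq_sqrt hw'
  have nz : ‖z‖ ^ 2 = z.re * z.re + z.im * z.im := by rw [Complex.sq_norm, Complex.normSq_apply]
  have nw : ‖w‖ ^ 2 = w.re * w.re + w.im * w.im := by rw [Complex.sq_norm, Complex.normSq_apply]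
  have ha2 : a ^ 2 = 1 := by
    rw [← h2, nz, ← h0, ← h1, mul_pow, sw, nw] at sz
    linarith
  rcases sq_eq_sq_iff_eq_or_eq_neg.mp (ha2.trans (one_pow 2).symm) with rfl | rfl
  · left
    exact Complex.ext (by linarith) (by linarith)
  · right
    have hs : Real.sqrt (1 - ‖z‖ ^ 2) = 0 := by
      linarith [Real.sqrt_nonneg (1 - ‖z‖ ^ 2), Real.sqrt_nonneg (1 - ‖w‖ ^ 2)]
    have := (Real.sqrt_eq_zero hz').mp hs
    exact ⟨by nlinarith [norm_nonneg z],
      Complex.ext (by simp only [Complex.neg_re]; linarith) (by simp only [Complex.neg_im]; linarith)⟩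

theorem discToRP2_neg {z : ℂ} (hz : ‖z‖ = 1) : discToRP2 (-z) = discToRP2 z := by
  rw [discToRP2, discToRP2, Projectivization.mk_eq_mk_iff']
  refine ⟨-1, ?_⟩
  funext i
  fin_cases i <;> simp [hemisphere, hz]

theorem isQuotientMap_discToRP2 :
    Topology.IsQuotientMap fun z : Metric.closedBall (0 : ℂ) 1 => discToRP2 z := by
  have : CompactSpace (Metric.closedBall (0 : ℂ) 1) :=
    isCompact_iff_compactSpace.mp (isCompact_closedBall 0 1)
  refine Topology.IsQuotientMap.of_surjective_continuous ?_
    (continuous_discToRP2.comp continuous_subtype_val)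
  intro p
  obtain ⟨z, hz, h⟩ := exists_discToRP2_eq p
  exact ⟨⟨z, by simpa using hz⟩, h⟩

instance : CompactSpace RP2 := by
  have : CompactSpace (Metric.closedBall (0 : ℂ) 1) :=
    isCompact_iff_compactSpace.mp (isCompact_closedBall 0 1)
  exact isQuotientMap_discToRP2.surjective.compactSpace isQuotientMap_discToRP2.continuous

theorem hasAngles_RP2 : HasAngles RP2 := by
  intro f
  obtain ⟨Θ, ⟨-, hΘ⟩, -⟩ := Circle.isCoveringMap_exp.existsUnique_continuousMap_lifts
    (f.comp ⟨discToRP2, continuous_discToRP2⟩) 0 _ (Circle.exp_arg _)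
  replace hΘ : ∀ z, Circle.exp (Θ z) = f (discToRP2 z) := congrFun hΘ
  have hanti : ∀ z : ℂ, ‖z‖ = 1 → Θ (-z) = Θ z := by
    intro z hz
    have := (isPreconnected_sphere (Complex.rank_real_complex ▸ Cardinal.one_lt_two) (0 : ℂ)
      1).eq_of_circleExp_eq_one (g := fun z => Θ (-z) - Θ z)
      (Continuous.continuousOn (by fun_prop))
      (fun z hz => by
        rw [Circle.exp_sub, hΘ, hΘ, discToRP2_neg (by simpa using hz), div_self'])
      (x := z) (y := -z) (by simpa using hz) (by simpa using hz)
    simp only [neg_neg] at this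
    linarith
  choose z hz hzp using exists_discToRP2_eq
  refine ⟨⟨fun p => Θ (z p), ?_⟩, fun p => (hΘ _).trans (congrArg f (hzp p))⟩
  rw [isQuotientMap_discToRP2.continuous_iff]
  refine (Θ.continuous.comp continuous_subtype_val).congr fun w => ?_
  have hw : ‖(w : ℂ)‖ ≤ 1 := mem_closedBall_zero_iff.mp w.2
  rcases eq_or_antipodal_of_discToRP2_eq (hz (discToRP2 w)) hw (hzp _) with h | ⟨h₁, h₂⟩
  · exact (congrArg Θ h).symm
  · exact (congrArg Θ h₂).trans (hanti _ h₁)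

end ProjectivePlane

section Quartics

theorem quarticValue_nonneg_iff (F : MvPolynomial (Fin 3) ℝ) (p : RP2) :
    0 ≤ quarticValue F p ↔ 0 ≤ MvPolynomial.eval p.rep F := by
  rw [quarticValue, le_div_iff₀ (pow_pos (sum_sq_pos p.rep_nonzero) 2), zero_mul]

theorem quarticValue_nonpos_iff (F : MvPolynomial (Fin 3) ℝ) (p : RP2) :
    quarticValue F p ≤ 0 ↔ MvPolynomial.eval p.rep F ≤ 0 := by
  rw [quarticValue, div_le_iff₀ (pow_pos (sum_sq_pos p.rep_nonzero) 2), zero_mul]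

theorem quarticValue_eq_zero_iff (F : MvPolynomial (Fin 3) ℝ) (p : RP2) :
    quarticValue F p = 0 ↔ p ∈ zeroSet F := by
  rw [quarticValue, div_eq_zero_iff]
  simp [(pow_pos (sum_sq_pos p.rep_nonzero) 2).ne', zeroSet]

theorem quarticValue_mk_nonneg_iff {F : MvPolynomial (Fin 3) ℝ} (hF : F.IsHomogeneous 4)
    {v : Fin 3 → ℝ} (hv : v ≠ 0) :
    0 ≤ quarticValue F (Projectivization.mk ℝ v hv) ↔ 0 ≤ MvPolynomial.eval v F := by
  rw [quarticValue_mk hF, le_div_iff₀ (pow_pos (sum_sq_pos hv) 2), zero_mul]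

theorem quarticValue_mk_nonpos_iff {F : MvPolynomial (Fin 3) ℝ} (hF : F.IsHomogeneous 4)
    {v : Fin 3 → ℝ} (hv : v ≠ 0) :
    quarticValue F (Projectivization.mk ℝ v hv) ≤ 0 ↔ MvPolynomial.eval v F ≤ 0 := by
  rw [quarticValue_mk hF, div_le_iff₀ (pow_pos (sum_sq_pos hv) 2), zero_mul]

theorem exists_sign_split {H : ℝ → ℝ} (hH : Continuous H) (h0 : 0 ≤ H 0) (h1 : H 1 ≤ 0)
    (h : ∀ x y, 0 < x → x < y → y < 1 → H x < 0 → H y ≤ 0) :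
    ∃ c ∈ Set.Icc (0 : ℝ) 1, (∀ x ∈ Set.Icc 0 c, 0 ≤ H x) ∧ ∀ x ∈ Set.Icc c 1, H x ≤ 0 := by
  let N : Set ℝ := insert 1 {y | y ∈ Set.Icc (0 : ℝ) 1 ∧ H y < 0}
  have hN : ∀ y ∈ N, 0 ≤ y := by
    rintro y (rfl | ⟨hy, -⟩)
    exacts [zero_le_one, hy.1]
  have hbdd : BddBelow N := ⟨0, hN⟩
  have h1N : (1 : ℝ) ∈ N := Or.inl rfl
  have hc0 : 0 ≤ sInf N := le_csInf ⟨1, h1N⟩ hN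
  have hc1 : sInf N ≤ 1 := csInf_le hbdd h1N
  have hclosedA : IsClosed {x | 0 ≤ H x} := isClosed_le continuous_const hH
  have hclosedB : IsClosed {x | H x ≤ 0} := isClosed_le hH continuous_const
  refine ⟨sInf N, ⟨hc0, hc1⟩, ?_, ?_⟩
  · rcases hc0.eq_or_lt with hc | hc
    · rw [← hc]
      intro x hx
      rwa [le_antisymm hx.2 hx.1]
    · rw [← closure_Ico hc.ne]
      refine fun x hx => closure_minimal (fun y hy => ?_) hclosedA hx
      by_contra hneg
      exact absurd (csInf_le hbdd (Or.inr ⟨⟨hy.1, hy.2.le.trans hc1⟩, not_le.mp hneg⟩)) hy.2.not_ge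
  · rcases hc1.eq_or_lt with hc | hc
    · rw [hc]
      intro x hx
      rwa [le_antisymm hx.2 hx.1]
    · rw [← closure_Ioc hc.ne]
      refine fun x hx => closure_minimal (fun y hy => ?_) hclosedB hx
      obtain ⟨x, hx, hxy⟩ := exists_lt_of_csInf_lt ⟨1, h1N⟩ hy.1
      rcases hx with rfl | ⟨hx, hHx⟩
      · exact absurd hy.2 hxy.not_ge
      · rcases hy.2.eq_or_lt with rfl | hy1
        · exact h1
        · refine h x y (hx.1.lt_of_ne ?_) hxy hy1 hHx
          rintro rfl
          exact absurd h0 hHx.not_ge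

theorem exists_eval_line_coeffs {F : MvPolynomial (Fin 3) ℝ} (hF : F.IsHomogeneous 4)
    (v w : Fin 3 → ℝ) : ∃ b c d : ℝ, ∀ s t : ℝ,
      MvPolynomial.eval (s • v + t • w) F = MvPolynomial.eval v F * s ^ 4 + b * (s ^ 3 * t) +
        c * (s ^ 2 * t ^ 2) + d * (s * t ^ 3) + MvPolynomial.eval w F * t ^ 4 := by
  let P : Polynomial ℝ := MvPolynomial.aeval
    (fun i => Polynomial.C (v i) + Polynomial.C (w i) * Polynomial.X) F
  have hP : ∀ t, P.eval t = MvPolynomial.eval (v + t • w) F := by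
    intro t
    have := MvPolynomial.comp_aeval_apply
      (fun i => Polynomial.C (v i) + Polynomial.C (w i) * Polynomial.X)
      (Polynomial.aeval t : Polynomial ℝ →ₐ[ℝ] ℝ) F
    rw [Polynomial.coe_aeval_eq_eval] at this
    refine this.trans ?_
    change MvPolynomial.eval _ F = _
    congr 2
    funext i
    simp only [Polynomial.eval_add, Polynomial.eval_mul, Polynomial.eval_C, Polynomial.eval_X,
      Pi.add_apply, Pi.smul_apply, smul_eq_mul]
    ring
  have hdeg : P.natDegree < 5 := by
    rw [Nat.lt_succ_iff]
    simp only [P, MvPolynomial.aeval_def, MvPolynomial.eval₂_eq]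
    refine Polynomial.natDegree_sum_le_of_forall_le _ _ fun d hd => ?_
    refine (Polynomial.natDegree_C_mul_le _ _).trans ((Polynomial.natDegree_prod_le _ _).trans ?_)
    rw [hF.degree_eq_sum_deg_support hd]
    refine Finset.sum_le_sum fun i _ => Polynomial.natDegree_pow_le.trans ?_
    refine (Nat.mul_le_mul_left _ (m := 1) ?_).trans (mul_one _).le
    compute_degree
  have hexp : ∀ t, MvPolynomial.eval (v + t • w) F = P.coeff 0 + P.coeff 1 * t + P.coeff 2 * t ^ 2 +
      P.coeff 3 * t ^ 3 + P.coeff 4 * t ^ 4 := by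
    intro t
    rw [← hP, Polynomial.eval_eq_sum_range' hdeg]
    simp [Finset.sum_range_succ]
  have hall : ∀ s t : ℝ, MvPolynomial.eval (s • v + t • w) F = P.coeff 0 * s ^ 4 +
      P.coeff 1 * (s ^ 3 * t) + P.coeff 2 * (s ^ 2 * t ^ 2) + P.coeff 3 * (s * t ^ 3) +
      P.coeff 4 * t ^ 4 := by
    intro s t
    refine congrFun (Continuous.ext_on (dense_compl_singleton (0 : ℝ))
      (f := fun s => MvPolynomial.eval (s • v + t • w) F)
      (g := fun s => P.coeff 0 * s ^ 4 + P.coeff 1 * (s ^ 3 * t) + P.coeff 2 * (s ^ 2 * t ^ 2) +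
        P.coeff 3 * (s * t ^ 3) + P.coeff 4 * t ^ 4)
      (F.continuous_eval.comp (by fun_prop)) (by fun_prop) fun s hs => ?_) s
    have hs : s ≠ 0 := hs
    have : s • v + t • w = s • (v + (t / s) • w) := by
      rw [smul_add, smul_smul, mul_div_cancel₀ _ hs]
    simp only [this, hF.eval_smul, hexp]
    field_simp
  have hv := hall 1 0
  have hw := hall 0 1
  simp at hv hw
  exact ⟨P.coeff 1, P.coeff 2, P.coeff 3, fun s t => by rw [hall, hv, hw]⟩

/-- A real quartic polynomial with nonnegative constant coefficient and nonpositive leading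
coefficient has few sign changes. -/
theorem quartic_sign_changes {a b c d e : ℝ} {h : ℝ → ℝ}
    (hh : ∀ t, h t = a + b * t + c * t ^ 2 + d * t ^ 3 + e * t ^ 4) (ha : 0 ≤ a) (he : e ≤ 0)
    {p q r s : ℝ} (hp : 0 < p) (hpq : p < q) (hr : 0 < r) (hrs : r < s) (h₁ : h p < 0)
    (h₂ : 0 < h q) (h₃ : h (-r) < 0) (h₄ : 0 < h (-s)) : False := by
  have hq := hp.trans hpq
  have hs := hr.trans hrs
  have hqp := sub_pos.mpr hpq
  have hsr := sub_pos.mpr hrs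
  have key : e = h q / ((q - p) * q * (q + r) * (q + s)) + -h p / ((q - p) * p * (p + r) * (p + s)) +
      a / (p * q * r * s) + -h (-r) / ((s - r) * r * (r + p) * (r + q)) +
      h (-s) / ((s - r) * s * (s + p) * (s + q)) := by
    simp only [hh]
    field_simp
    ring
  have h₁' := neg_pos.mpr h₁
  have h₃' := neg_pos.mpr h₃
  have : 0 < e := by
    rw [key]
    positivity
  linarith

/-- Either a segment joining two points consists of a nonnegative and a nonpositive part, or the
form changes sign in the wrong direction on it. -/
theorem exists_connectedWithin_or_sign_change {F : MvPolynomial (Fin 3) ℝ}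
    (hF : F.IsHomogeneous 4) {v w : Fin 3 → ℝ} (hv : v ≠ 0) (hw : w ≠ 0)
    (hvw : ∀ s t : ℝ, s • v + t • w = 0 → s = 0 ∧ t = 0)
    (hFv : 0 ≤ MvPolynomial.eval v F) (hFw : MvPolynomial.eval w F ≤ 0) :
    (∃ z, ConnectedWithin {z | 0 ≤ quarticValue F z} (Projectivization.mk ℝ v hv) z ∧
      ConnectedWithin {z | quarticValue F z ≤ 0} z (Projectivization.mk ℝ w hw)) ∨
    ∃ p q : ℝ, 0 < p ∧ p < q ∧ MvPolynomial.eval (v + p • w) F < 0 ∧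
      0 < MvPolynomial.eval (v + q • w) F := by
  let H : ℝ → ℝ := fun x => MvPolynomial.eval ((1 - x) • v + x • w) F
  have hH : Continuous H := F.continuous_eval.comp (by fun_prop)
  have hne : ∀ x : ℝ, (1 - x) • v + x • w ≠ 0 := by
    intro x hx
    obtain ⟨h₁, h₂⟩ := hvw _ _ hx
    linarith
  let γ : ℝ → RP2 := fun x => Projectivization.mk ℝ _ (hne x)
  have hγ : Continuous γ := RP2.continuous_mk (by fun_prop) hne
  by_cases h : ∀ x y, 0 < x → x < y → y < 1 → H x < 0 → H y ≤ 0
  · left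
    obtain ⟨c, hc, hA, hB⟩ := exists_sign_split hH (by simpa [H] using hFv) (by simpa [H] using hFw) h
    refine ⟨γ c, ⟨γ '' Set.Icc 0 c, ?_, isPreconnected_Icc.image _ hγ.continuousOn,
      ⟨0, ⟨le_rfl, hc.1⟩, by simp [γ]⟩, ⟨c, ⟨hc.1, le_rfl⟩, rfl⟩⟩,
      ⟨γ '' Set.Icc c 1, ?_, isPreconnected_Icc.image _ hγ.continuousOn,
      ⟨c, ⟨le_rfl, hc.2⟩, rfl⟩, ⟨1, ⟨hc.2, le_rfl⟩, by simp [γ]⟩⟩⟩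
    · rintro _ ⟨x, hx, rfl⟩
      exact (quarticValue_mk_nonneg_iff hF (hne x)).mpr (hA x hx)
    · rintro _ ⟨x, hx, rfl⟩
      exact (quarticValue_mk_nonpos_iff hF (hne x)).mpr (hB x hx)
  · right
    push Not at h
    obtain ⟨x, y, hx, hxy, hy, hHx, hHy⟩ := h
    have scale : ∀ x < 1, H x = (1 - x) ^ 4 * MvPolynomial.eval (v + (x / (1 - x)) • w) F := by
      intro x hx
      rw [← hF.eval_smul, smul_add, smul_smul, mul_div_cancel₀ _ (sub_pos.mpr hx).ne']
    have hx1 : 0 < 1 - x := by linarith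
    have hy1 : 0 < 1 - y := by linarith
    rw [scale x (hxy.trans hy)] at hHx
    rw [scale y hy] at hHy
    refine ⟨x / (1 - x), y / (1 - y), by positivity, ?_, ?_, ?_⟩
    · rw [div_lt_div_iff₀ hx1 hy1]
      linarith
    · exact neg_of_mul_neg_right hHx (by positivity)
    · exact pos_of_mul_pos_right hHy (by positivity)

theorem exists_connectedWithin_quarticValue {F : MvPolynomial (Fin 3) ℝ} (hF : F.IsHomogeneous 4)
    {a b : RP2} (ha : 0 ≤ quarticValue F a) (hb : quarticValue F b ≤ 0) :
    ∃ z, ConnectedWithin {z | 0 ≤ quarticValue F z} a z ∧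
      ConnectedWithin {z | quarticValue F z ≤ 0} z b := by
  rcases eq_or_ne a b with rfl | hab
  · exact ⟨a, ⟨{a}, by simpa using ha, isPreconnected_singleton, rfl, rfl⟩,
      ⟨{a}, by simpa using hb, isPreconnected_singleton, rfl, rfl⟩⟩
  have hind := LinearIndependent.pair_iff.mp (Projectivization.linearIndependent_pair_iff_ne.mpr hab)
  rw [quarticValue_nonneg_iff] at ha
  rw [quarticValue_nonpos_iff] at hb
  have hneg : MvPolynomial.eval (-b.rep) F = MvPolynomial.eval b.rep F := by
    simpa [Even.neg_pow (by decide : Even 4)] using hF.eval_smul (-1) b.rep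
  have h₁ := exists_connectedWithin_or_sign_change hF a.rep_nonzero b.rep_nonzero hind ha hb
  have h₂ := exists_connectedWithin_or_sign_change hF a.rep_nonzero
    (neg_ne_zero.mpr b.rep_nonzero) (fun s t hst => by
      have := hind s (-t) (by simpa using hst)
      simpa using this) ha (hneg.trans_le hb)
  have hmk : Projectivization.mk ℝ (-b.rep) (neg_ne_zero.mpr b.rep_nonzero) = b := by
    conv_rhs => rw [← b.mk_rep]
    rw [Projectivization.mk_eq_mk_iff']
    exact ⟨-1, by simp⟩
  rw [hmk, Projectivization.mk_rep] at h₂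
  rw [Projectivization.mk_rep, Projectivization.mk_rep] at h₁
  rcases h₁ with h₁ | ⟨p, q, hp, hpq, hFp, hFq⟩
  · exact h₁
  rcases h₂ with h₂ | ⟨r, s, hr, hrs, hFr, hFs⟩
  · exact h₂
  obtain ⟨β, γ, δ, hline⟩ := exists_eval_line_coeffs hF a.rep b.rep
  rw [smul_neg, ← neg_smul] at hFr hFs
  exact (quartic_sign_changes (h := fun t => MvPolynomial.eval (a.rep + t • b.rep) F)
    (fun t => by simpa using hline 1 t) ha hb hp hpq hr hrs hFp hFq hFr hFs).elim

/-- The quartic forms vanishing at `13` points contain a pencil. -/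
theorem exists_quartic_pencil (v : Fin 13 → Fin 3 → ℝ) :
    ∃ F G : MvPolynomial (Fin 3) ℝ, F.IsHomogeneous 4 ∧ G.IsHomogeneous 4 ∧
      (∀ i, MvPolynomial.eval (v i) F = 0) ∧ (∀ i, MvPolynomial.eval (v i) G = 0) ∧
      LinearIndependent ℝ ![F, G] := by
  let ι := {d // d ∈ Finset.Nat.antidiagonalTuple 3 4}
  let m : ι → MvPolynomial (Fin 3) ℝ := fun d =>
    MvPolynomial.monomial (Finsupp.equivFunOnFinite.symm d.1) 1
  have hm : LinearIndependent ℝ m := by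
    have := (MvPolynomial.basisMonomials (Fin 3) ℝ).linearIndependent.comp
      (fun d : ι => Finsupp.equivFunOnFinite.symm d.1)
      (Finsupp.equivFunOnFinite.symm.injective.comp Subtype.val_injective)
    simpa [Function.comp_def, m] using this
  have hmhom : ∀ d, (m d).IsHomogeneous 4 := by
    intro d
    refine MvPolynomial.isHomogeneous_monomial _ ?_
    rw [Finsupp.degree_eq_sum]
    exact Finset.Nat.mem_antidiagonalTuple.mp d.2
  let Φ := Fintype.linearCombination ℝ m
  have hΦ : Function.Injective Φ := hm.fintypeLinearCombination_injective
  have hΦhom : ∀ c, (Φ c).IsHomogeneous 4 := fun c => by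
    rw [Fintype.linearCombination_apply]
    refine MvPolynomial.IsHomogeneous.sum _ _ _ fun d _ => ?_
    exact (MvPolynomial.homogeneousSubmodule (Fin 3) ℝ 4).smul_mem _ (hmhom d)
  let E : (ι → ℝ) →ₗ[ℝ] (Fin 13 → ℝ) :=
    LinearMap.pi fun i => (MvPolynomial.aeval (v i)).toLinearMap ∘ₗ Φ
  have hE : ∀ c ∈ LinearMap.ker E, ∀ i, MvPolynomial.eval (v i) (Φ c) = 0 := fun c hc i => by
    simpa [E, MvPolynomial.coe_aeval_eq_eval] using congrFun hc i
  have hcard : Fintype.card ι = 15 := by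
    rw [Fintype.card_coe]
    decide
  have hrank := E.finrank_range_add_finrank_ker
  have hrange := E.range.finrank_le
  rw [Module.finrank_fintype_fun_eq_card] at hrank hrange
  rw [hcard] at hrank
  rw [Fintype.card_fin] at hrange
  have hker : 1 < Module.finrank ℝ (LinearMap.ker E) := by lia
  have : Nontrivial (LinearMap.ker E) := Module.nontrivial_of_finrank_pos (R := ℝ) (by lia)
  obtain ⟨x, hx⟩ := exists_ne (0 : LinearMap.ker E)
  obtain ⟨y, hxy⟩ := exists_linearIndependent_pair_of_one_lt_finrank hker hx
  refine ⟨Φ x, Φ y, hΦhom _, hΦhom _, hE _ x.2, hE _ y.2, ?_⟩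
  rw [LinearIndependent.pair_iff] at hxy ⊢
  intro s t hst
  refine hxy s t (Subtype.ext (hΦ ?_))
  simpa using hst

/-- Any `13` points are connected within the real point set of some quartic curve. -/
theorem exists_quartic_connectedWithin (p : Fin 13 → RP2) :
    ∃ F : MvPolynomial (Fin 3) ℝ, F ≠ 0 ∧ F.IsHomogeneous 4 ∧
      ∀ i j, ConnectedWithin (zeroSet F) (p i) (p j) := by
  obtain ⟨F, G, hF, hG, hFp, hGp, hFG⟩ := exists_quartic_pencil fun i => (p i).rep
  let K : ℝ → MvPolynomial (Fin 3) ℝ := fun t => Real.cos t • F + Real.sin t • G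
  have hK : ∀ t, (K t).IsHomogeneous 4 := fun t =>
    (MvPolynomial.homogeneousSubmodule (Fin 3) ℝ 4).add_mem
      (Submodule.smul_mem _ _ hF) (Submodule.smul_mem _ _ hG)
  have hval : ∀ t z, Real.cos t * quarticValue F z + Real.sin t * quarticValue G z =
      quarticValue (K t) z := by
    intro t z
    simp only [quarticValue, K, map_add, MvPolynomial.smul_eval]
    ring
  obtain ⟨t, ht⟩ := hasAngles_RP2.exists_connectedWithin_pencil
    ⟨_, continuous_quarticValue hF⟩ ⟨_, continuous_quarticValue hG⟩ (S := Set.range p)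
    (by rintro _ ⟨i, rfl⟩; exact (quarticValue_eq_zero_iff F _).mpr (hFp i))
    (by rintro _ ⟨i, rfl⟩; exact (quarticValue_eq_zero_iff G _).mpr (hGp i))
    (fun t a b ha hb => by
      simp only [ContinuousMap.coe_mk, hval] at ha hb ⊢
      exact exists_connectedWithin_quarticValue (hK t) ha hb)
  refine ⟨K t, ?_, hK t, fun i j => ?_⟩
  · intro h0
    obtain ⟨hc, hs⟩ := LinearIndependent.pair_iff.mp hFG _ _ h0
    have := Real.cos_sq_add_sin_sq t
    simp [hc, hs] at this
  · refine (ht _ ⟨i, rfl⟩ _ ⟨j, rfl⟩).mono fun z hz => ?_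
    have hz : Real.cos t * quarticValue F z + Real.sin t * quarticValue G z = 0 := hz
    rwa [hval, quarticValue_eq_zero_iff] at hz

end Quartics

/-- For every `q ≥ 4` divisible by 4, through any `3q + 1` points of `ℝP²` one can trace a
connected component of the real point set of a real curve of degree `q` (for `q = 4k` the
bound `3q - 1 = 12k - 1` improves to `12k + 1`). -/
theorem stmt_10 (q : ℕ) (hq : 4 ≤ q) (hq4 : 4 ∣ q) (p : Fin (3 * q + 1) → RP2) :
    ∃ F : MvPolynomial (Fin 3) ℝ, F ≠ 0 ∧ F.IsHomogeneous q ∧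
      inOneComponent (zeroSet F) (Set.range p) := by
  obtain ⟨k, rfl⟩ := hq4
  have hk : 0 < k := by lia
  let P : Fin k → Fin 13 → RP2 := fun i j =>
    p ⟨if j.1 = 0 then 0 else 12 * i.1 + j.1, by split_ifs <;> lia⟩
  choose F hF0 hF hconn using fun i => exists_quartic_connectedWithin (P i)
  have hsub : ∀ i, zeroSet (F i) ⊆ zeroSet (∏ i, F i) := by
    intro i z hz
    have hz : MvPolynomial.eval z.rep (F i) = 0 := hz
    change MvPolynomial.eval z.rep (∏ i, F i) = 0
    rw [map_prod]
    exact Finset.prod_eq_zero (Finset.mem_univ i) hz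
  have hall : ∀ n, ConnectedWithin (zeroSet (∏ i, F i)) (p 0) (p n) := by
    intro n
    by_cases hn : n.1 = 0
    · have h := (hconn ⟨0, hk⟩ 0 0).mono (hsub _)
      have : n = 0 := Fin.ext hn
      rw [this]
      exact h
    · have h := (hconn ⟨(n.1 - 1) / 12, by lia⟩ 0 ⟨(n.1 - 1) % 12 + 1, by lia⟩).mono (hsub _)
      have : n = ⟨12 * ((n.1 - 1) / 12) + ((n.1 - 1) % 12 + 1), by lia⟩ := Fin.ext (by
        simp only []
        lia)
      rw [this]
      exact h
  refine ⟨∏ i, F i, Finset.prod_ne_zero_iff.mpr fun i _ => hF0 i, ?_, p 0, (hall 0).left_mem, ?_⟩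
  · have := MvPolynomial.IsHomogeneous.prod Finset.univ F (fun _ => 4) fun i _ => hF i
    simpa [mul_comm] using this
  · rintro _ ⟨n, rfl⟩
    obtain ⟨C, hC, hCp, h0, hn⟩ := hall n
    exact hCp.subset_connectedComponentIn h0 hC hn
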